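/- Let F, R, ρ₀, ρₓ > 0, let α ∈ (0, π) satisfy 3·sin α ≤ α, and set C₁ = 1 − 2 F ρ₀ R sin(α/2), C₂ = F ρₓ R² sin α, C₃ = F ρₓ R² α. Define v(θ) = (−C₃/4, 0) + C₁·(cos θ, sin θ) − (C₂/4)·(cos 2θ, sin 2θ). If C₁ > (C₂ + C₃)/4 (the velocity profile contains the origin), then v₁'(θ) v₂''(θ) − v₂'(θ) v₁''(θ) > 0 for every θ ∈ ℝ; i.e., the velocity profile is strictly convex. -/

import Mathlib

open Real in
theorem deriv_const_add_cos_sub_cos_two_mul (c a b : ℝ) :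
    deriv (fun t => c + a * cos t - b * cos (2 * t)) =
      fun t => -a * sin t + 2 * b * sin (2 * t) := by
  funext t
  have h2 : HasDerivAt (fun t : ℝ => 2 * t) 2 t := by
    simpa using (hasDerivAt_id t).const_mul (2 : ℝ)
  refine HasDerivAt.deriv ?_
  convert (((hasDerivAt_cos t).const_mul a).const_add c).fun_sub (h2.cos.const_mul b) using 1
  ring

open Real in
theorem deriv_mul_sin_add_mul_sin_two_mul (a b : ℝ) :
    deriv (fun t => a * sin t + b * sin (2 * t)) =
      fun t => a * cos t + 2 * b * cos (2 * t) := by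
  funext t
  have h2 : HasDerivAt (fun t : ℝ => 2 * t) 2 t := by
    simpa using (hasDerivAt_id t).const_mul (2 : ℝ)
  refine HasDerivAt.deriv ?_
  convert ((hasDerivAt_sin t).const_mul a).fun_add (h2.sin.const_mul b) using 1
  ring

/-- For the intra-crowd model with linear density: if `3 sin α ≤ α` and the
velocity profile `v(θ) = (−C₃/4, 0) + C₁ (cos θ, sin θ) − (C₂/4)(cos 2θ, sin 2θ)`
(with `C₁ = 1 − 2Fρ₀R sin(α/2)`, `C₂ = FρₓR² sin α`, `C₃ = FρₓR² α`) contains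
the origin (`C₁ > (C₂ + C₃)/4`), then its curvature numerator is everywhere
positive, i.e. the profile is strictly convex. -/
theorem intra_crowd_convexity (F R ρ₀ ρₓ α C₁ C₂ C₃ : ℝ)
    (hF : 0 < F) (hR : 0 < R) (hρ₀ : 0 < ρ₀) (hρₓ : 0 < ρₓ)
    (hα : α ∈ Set.Ioo (0 : ℝ) Real.pi) (hsin : 3 * Real.sin α ≤ α)
    (hC₁ : C₁ = 1 - 2 * F * ρ₀ * R * Real.sin (α / 2))
    (hC₂ : C₂ = F * ρₓ * R ^ 2 * Real.sin α)
    (hC₃ : C₃ = F * ρₓ * R ^ 2 * α)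
    (horigin : C₁ > (C₂ + C₃) / 4) :
    ∀ θ : ℝ, 0 <
      deriv (fun t => -C₃ / 4 + C₁ * Real.cos t - C₂ / 4 * Real.cos (2 * t)) θ *
          deriv (deriv (fun t => C₁ * Real.sin t - C₂ / 4 * Real.sin (2 * t))) θ -
        deriv (fun t => C₁ * Real.sin t - C₂ / 4 * Real.sin (2 * t)) θ *
          deriv (deriv
            (fun t => -C₃ / 4 + C₁ * Real.cos t - C₂ / 4 * Real.cos (2 * t))) θ := by
  intro θ
  have hs : 0 < Real.sin α := Real.sin_pos_of_pos_of_lt_pi hα.1 hα.2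
  have hk : 0 < F * ρₓ * R ^ 2 := by positivity
  have hC₂_pos : 0 < C₂ := hC₂ ▸ mul_pos hk hs
  have hC₂_lt : C₂ < C₁ := by
    have := mul_le_mul_of_nonneg_left hsin hk.le
    linarith
  have hx := deriv_const_add_cos_sub_cos_two_mul (-C₃ / 4) C₁ (C₂ / 4)
  have hy : deriv (fun t => C₁ * Real.sin t - C₂ / 4 * Real.sin (2 * t)) =
      fun t => 0 + C₁ * Real.cos t - C₂ / 2 * Real.cos (2 * t) := by
    have h := deriv_mul_sin_add_mul_sin_two_mul C₁ (-(C₂ / 4))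
    simp only [neg_mul, ← sub_eq_add_neg] at h
    rw [h]
    funext t
    ring
  rw [hx, hy, deriv_const_add_cos_sub_cos_two_mul, deriv_mul_sin_add_mul_sin_two_mul]
  calc
    0 < (C₁ - C₂) * (C₁ - C₂ / 2) + 3 / 2 * (C₁ * C₂) * (1 - Real.cos θ) := by
      have hcos : 0 ≤ 1 - Real.cos θ := sub_nonneg.mpr (Real.cos_le_one θ)
      have h₁ : 0 < C₁ - C₂ := by linarith
      have h₂ : 0 < C₁ - C₂ / 2 := by linarith
      have h₃ : 0 < C₁ := by linarith
      positivity
    _ = _ := by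
      have hc : Real.cos θ =
          Real.cos (2 * θ) * Real.cos θ + Real.sin (2 * θ) * Real.sin θ := by
        rw [← Real.cos_sub]
        ring_nf
      linear_combination -(3 / 2 * (C₁ * C₂)) * hc - C₁ ^ 2 * Real.sin_sq_add_cos_sq θ -
        C₂ ^ 2 / 2 * Real.sin_sq_add_cos_sq (2 * θ)
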